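/- arXiv:2205.08897 — 2 statements merged into one kernel-verified Lean document; each statement's English description precedes it below -/
import Mathlib

section
/- Let θ > 0, t ∈ ℝ, and N ≥ 1 a natural number. There is an absolute constant C > 0 (independent of θ, t, N, L, and f) such that for every L ≥ 0 and every function f : ℝ → ℝ that is L-Lipschitz, there exists a real polynomial p of degree at most N - 1 satisfying (∫ |f(x) - p(x)|² dμ^{(t)}(x))^{1/2} ≤ C · θ · L / √N. (Equivalently, the L²(μ^{(t)})-distance from f to the space of polynomials of degree less than N is at most C θ L / √N.) -/
open MeasureTheory

open Polynomial in
/-- A `K`-Lipschitz function on `[0, 1]` is approximated by its Bernstein polynomial of degree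
at most `n` with pointwise squared error at most `K ^ 2 / (4 * n)`. -/
theorem exists_natDegree_le_sq_sub_eval_le_of_lipschitz {n : ℕ} (hn : 0 < n) {K : ℝ} {g : ℝ → ℝ}
    (hg : ∀ x y : ℝ, |g x - g y| ≤ K * |x - y|) :
    ∃ p : ℝ[X], p.natDegree ≤ n ∧
      ∀ y ∈ Set.Icc (0 : ℝ) 1, (g y - p.eval y) ^ 2 ≤ K ^ 2 / (4 * n) := by
  refine ⟨∑ k ∈ Finset.range (n + 1), C (g (k / n)) * bernsteinPolynomial ℝ n k,
    natDegree_sum_le_of_forall_le _ _ fun k hk => ?_, fun y hy => ?_⟩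
  · have hk' : k ≤ n := Nat.lt_succ_iff.mp (Finset.mem_range.mp hk)
    unfold bernsteinPolynomial
    compute_degree
    omega
  have hn' : (0 : ℝ) < n := by exact_mod_cast hn
  set b : ℕ → ℝ := fun k => (bernsteinPolynomial ℝ n k).eval y with hb
  have hb0 : ∀ k, 0 ≤ b k := fun k => by
    have := hy.1
    have := sub_nonneg.mpr hy.2
    simp only [hb, bernsteinPolynomial, eval_mul, eval_pow, eval_sub, eval_one, eval_X,
      eval_natCast]
    positivity
  have hsum : ∑ k ∈ Finset.range (n + 1), b k = 1 := by
    simpa [eval_finsetSum] using congrArg (eval y) (bernsteinPolynomial.sum ℝ n)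
  have hvar : ∑ k ∈ Finset.range (n + 1), b k * (n * y - k) ^ 2 = n * y * (1 - y) := by
    simpa [eval_finsetSum, hb, mul_comm, sub_sq_comm, mul_assoc, mul_left_comm] using
      congrArg (eval y) (bernsteinPolynomial.variance ℝ n)
  have hdiff : g y - (∑ k ∈ Finset.range (n + 1),
      C (g (k / n)) * bernsteinPolynomial ℝ n k).eval y =
      ∑ k ∈ Finset.range (n + 1), b k * (g y - g (k / n)) := by
    simp only [mul_sub, Finset.sum_sub_distrib, ← Finset.sum_mul, hsum, one_mul,
      eval_finsetSum, eval_mul, eval_C]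
    simp only [hb, mul_comm]
  rw [hdiff]
  calc (∑ k ∈ Finset.range (n + 1), b k * (g y - g (k / n))) ^ 2
      ≤ ∑ k ∈ Finset.range (n + 1), b k * (g y - g (k / n)) ^ 2 :=
        (Even.convexOn_pow even_two).map_sum_le (fun k _ => hb0 k) hsum fun _ _ => Set.mem_univ _
    _ ≤ ∑ k ∈ Finset.range (n + 1), K ^ 2 / n ^ 2 * (b k * (n * y - k) ^ 2) := by
        refine Finset.sum_le_sum fun k _ => ?_
        have h : (g y - g (k / n)) ^ 2 ≤ (K * |y - k / n|) ^ 2 := by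
          rw [← sq_abs (g y - g (k / n))]
          exact pow_le_pow_left₀ (abs_nonneg _) (hg _ _) 2
        rw [mul_pow, sq_abs] at h
        calc b k * (g y - g (k / n)) ^ 2 ≤ b k * (K ^ 2 * (y - k / n) ^ 2) :=
              mul_le_mul_of_nonneg_left h (hb0 k)
          _ = K ^ 2 / n ^ 2 * (b k * (n * y - k) ^ 2) := by field_simp
    _ = K ^ 2 / n * (y * (1 - y)) := by
        rw [← Finset.mul_sum, hvar]
        field_simp
    _ ≤ K ^ 2 / n * (1 / 4) := by
        gcongr
        nlinarith [sq_nonneg (2 * y - 1)]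
    _ = K ^ 2 / (4 * n) := by field_simp

open Polynomial in
/-- A `K`-Lipschitz function on `[0, 1]` is approximated by a polynomial of degree less than `N`
with pointwise squared error at most `K ^ 2 / N`. -/
theorem exists_natDegree_le_pred_sq_sub_eval_le_of_lipschitz {N : ℕ} (hN : 1 ≤ N) {K : ℝ}
    {g : ℝ → ℝ} (hg : ∀ x y : ℝ, |g x - g y| ≤ K * |x - y|) :
    ∃ p : ℝ[X], p.natDegree ≤ N - 1 ∧
      ∀ y ∈ Set.Icc (0 : ℝ) 1, (g y - p.eval y) ^ 2 ≤ K ^ 2 / N := by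
  obtain ⟨n, rfl⟩ := Nat.exists_eq_add_of_le' hN
  rcases n.eq_zero_or_pos with rfl | hn
  · refine ⟨C (g 0), by simp, fun y hy => ?_⟩
    have h := pow_le_pow_left₀ (abs_nonneg _) (hg y 0) 2
    rw [sq_abs, mul_pow, sq_abs, sub_zero] at h
    have hy2 : y ^ 2 ≤ 1 := pow_le_one₀ hy.1 hy.2
    simpa using h.trans (mul_le_of_le_one_right (sq_nonneg K) hy2)
  · obtain ⟨p, hp, h⟩ := exists_natDegree_le_sq_sub_eval_le_of_lipschitz hn hg
    refine ⟨p, hp, fun y hy => (h y hy).trans ?_⟩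
    have hn' : (1 : ℝ) ≤ n := by exact_mod_cast hn
    push_cast
    gcongr
    linarith

/-- **Theorem 1 (first half) of FiLM.** For the uniform probability measure
`μ^{(t)} = θ⁻¹ · Leb|_{[t-θ,t]}`, every `L`-Lipschitz function `f : ℝ → ℝ` admits a
polynomial approximation of degree at most `N - 1` with `L²(μ^{(t)})` error at most
`C · θ · L / √N`, for an absolute constant `C`. -/
theorem legendre_projection_error_lipschitz :
    ∃ C : ℝ, 0 < C ∧
      ∀ (θ t : ℝ), 0 < θ → ∀ N : ℕ, 1 ≤ N → ∀ L : ℝ, 0 ≤ L →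
        ∀ f : ℝ → ℝ, (∀ x y : ℝ, |f x - f y| ≤ L * |x - y|) →
          ∃ p : Polynomial ℝ, p.natDegree ≤ N - 1 ∧
            Real.sqrt (∫ x, (f x - p.eval x) ^ 2
                ∂((ENNReal.ofReal θ)⁻¹ • volume.restrict (Set.Icc (t - θ) t)))
              ≤ C * θ * L / Real.sqrt N := by
  refine ⟨1, one_pos, fun θ t hθ N hN L hL f hf => ?_⟩
  have hg : ∀ x y : ℝ, |f (t - θ + θ * x) - f (t - θ + θ * y)| ≤ θ * L * |x - y| := fun x y => by
    refine (hf _ _).trans_eq ?_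
    rw [add_sub_add_left_eq_sub, ← mul_sub, abs_mul, abs_of_pos hθ]
    ring
  obtain ⟨q, hq, hqe⟩ := exists_natDegree_le_pred_sq_sub_eval_le_of_lipschitz hN hg
  set r : Polynomial ℝ := Polynomial.C θ⁻¹ * Polynomial.X + Polynomial.C (-(t - θ) / θ) with hr
  refine ⟨q.comp r, ?_, ?_⟩
  · calc (q.comp r).natDegree ≤ q.natDegree * r.natDegree := Polynomial.natDegree_comp_le
      _ ≤ q.natDegree * 1 := Nat.mul_le_mul_left _ Polynomial.natDegree_linear_le
      _ ≤ N - 1 := by rwa [mul_one]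
  have hpt : ∀ x ∈ Set.Icc (t - θ) t, (f x - (q.comp r).eval x) ^ 2 ≤ (θ * L) ^ 2 / N := by
    intro x hx
    have hy : (x - (t - θ)) / θ ∈ Set.Icc (0 : ℝ) 1 :=
      ⟨div_nonneg (sub_nonneg.mpr hx.1) hθ.le, (div_le_one hθ).mpr (by linarith [hx.2])⟩
    have hx' : t - θ + θ * ((x - (t - θ)) / θ) = x := by
      field_simp
      ring
    have hrx : r.eval x = (x - (t - θ)) / θ := by
      simp only [hr, Polynomial.eval_add, Polynomial.eval_mul, Polynomial.eval_C,
        Polynomial.eval_X]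
      ring
    have h := hqe _ hy
    rwa [hx', ← hrx, ← Polynomial.eval_comp] at h
  have hbound : ∫ x, (f x - (q.comp r).eval x) ^ 2
      ∂((ENNReal.ofReal θ)⁻¹ • volume.restrict (Set.Icc (t - θ) t)) ≤ (θ * L) ^ 2 / N := by
    have h := norm_setIntegral_le_of_norm_le_const (μ := volume) (s := Set.Icc (t - θ) t)
      (f := fun x => (f x - (q.comp r).eval x) ^ 2) measure_Icc_lt_top fun x hx => by
        simpa using hpt x hx
    have h' := (Real.le_norm_self _).trans h
    rw [Real.volume_real_Icc, sub_sub_cancel, max_eq_left hθ.le] at h'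
    rw [integral_smul_measure, ENNReal.toReal_inv, ENNReal.toReal_ofReal hθ.le, smul_eq_mul]
    exact (inv_mul_le_iff₀ hθ).mpr (h'.trans_eq (mul_comm _ _))
  refine (Real.sqrt_le_sqrt hbound).trans_eq ?_
  rw [Real.sqrt_div (sq_nonneg _), Real.sqrt_sq (by positivity), one_mul]
end

section
/- Let θ > 0, t ∈ ℝ, and k ≥ 1 a natural number. There is a constant C_k > 0 depending only on k such that for every M ≥ 0, every natural number N ≥ k, and every function f : ℝ → ℝ that is k times continuously differentiable on [t - θ, t] with |f^{(k)}(x)| ≤ M for all x ∈ [t - θ, t], there exists a real polynomial p of degree at most N - 1 satisfying (∫ |f(x) - p(x)|² dμ^{(t)}(x))^{1/2} ≤ C_k · M · θ^k · N^{-k + 1/2}. -/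
open MeasureTheory

/-- The `n`-th cosine coefficient of a function on `[-π, π]`. -/
noncomputable def cosCoeff (g : ℝ → ℝ) (n : ℤ) : ℝ :=
  (2 * Real.pi)⁻¹ * ∫ x in (-Real.pi)..Real.pi, Real.cos (n * x) * g x

theorem neg_pi_lt_pi : -Real.pi < Real.pi := by linarith [Real.pi_pos]

theorem fourier_two_pi_apply (n : ℤ) (x : ℝ) :
    fourier n (x : AddCircle (Real.pi - -Real.pi)) = Complex.exp (n * x * Complex.I) := by
  rw [fourier_coe_apply]
  congr 1
  have : (Real.pi : ℂ) ≠ 0 := Complex.ofReal_ne_zero.2 Real.pi_ne_zero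
  push_cast
  field_simp
  ring

theorem fourierCoeffOn_ofReal_of_even {g : ℝ → ℝ} (hg : Continuous g) (heven : ∀ x, g (-x) = g x)
    (n : ℤ) :
    fourierCoeffOn neg_pi_lt_pi (fun x => (g x : ℂ)) n = (cosCoeff g n : ℂ) := by
  have h1 : ∫ x in (-Real.pi)..Real.pi, Complex.exp (-n * x * Complex.I) * g x =
      ∫ x in (-Real.pi)..Real.pi, Complex.exp (n * x * Complex.I) * g x := by
    have := intervalIntegral.integral_comp_neg (a := -Real.pi) (b := Real.pi)
      (fun x : ℝ => Complex.exp (n * x * Complex.I) * g x)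
    rw [neg_neg] at this
    rw [← this]
    refine intervalIntegral.integral_congr fun x _ => ?_
    simp [heven]
  have h2 : ∫ x in (-Real.pi)..Real.pi, ((Real.cos (n * x) * g x : ℝ) : ℂ) =
      ∫ x in (-Real.pi)..Real.pi, Complex.exp (-n * x * Complex.I) * g x := by
    have h3 : ∀ x : ℝ, ((Real.cos (n * x) * g x : ℝ) : ℂ) =
        (Complex.exp (n * x * Complex.I) * g x + Complex.exp (-n * x * Complex.I) * g x) / 2 := by
      intro x
      push_cast
      rw [Complex.cos]
      ring_nf
    simp_rw [h3]
    rw [intervalIntegral.integral_div, intervalIntegral.integral_add, ← h1]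
    · ring
    all_goals exact Continuous.intervalIntegrable (by fun_prop) _ _
  rw [fourierCoeffOn_eq_integral, cosCoeff]
  simp_rw [fourier_two_pi_apply]
  push_cast [← intervalIntegral.integral_ofReal] at h2 ⊢
  simp only [smul_eq_mul]
  rw [h2, Complex.real_smul]
  push_cast
  ring

theorem integral_cos_int_mul (n : ℤ) :
    ∫ x in (-Real.pi)..Real.pi, Real.cos (n * x) = if n = 0 then 2 * Real.pi else 0 := by
  split_ifs with h
  · subst h
    simp
    ring
  · have hn : (n : ℝ) ≠ 0 := Int.cast_ne_zero.2 h
    rw [intervalIntegral.integral_comp_mul_left (fun x => Real.cos x) hn]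
    simp [Real.sin_int_mul_pi]

theorem cosCoeff_cos (m n : ℤ) :
    cosCoeff (fun x => Real.cos (m * x)) n =
      ((if n = m then 1 else 0) + (if n = -m then 1 else 0)) / 2 := by
  have h : ∀ x : ℝ, Real.cos (n * x) * Real.cos (m * x) =
      (Real.cos ((n - m : ℤ) * x) + Real.cos ((n + m : ℤ) * x)) / 2 := by
    intro x
    push_cast
    rw [sub_mul, add_mul, Real.cos_sub, Real.cos_add]
    ring
  have hpi := Real.pi_ne_zero
  rw [cosCoeff]
  simp_rw [h]
  rw [intervalIntegral.integral_div, intervalIntegral.integral_add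
    (Continuous.intervalIntegrable (by fun_prop) _ _)
    (Continuous.intervalIntegrable (by fun_prop) _ _), integral_cos_int_mul, integral_cos_int_mul]
  simp only [sub_eq_zero, add_eq_zero_iff_eq_neg]
  split_ifs <;> field_simp <;> norm_num

theorem cosCoeff_neg (g : ℝ → ℝ) (n : ℤ) : cosCoeff g (-n) = cosCoeff g n := by
  simp [cosCoeff]

theorem cosCoeff_sub_sum_cos {g : ℝ → ℝ} (hg : Continuous g) (s : Finset ℤ) (a : ℤ → ℝ) (n : ℤ) :
    cosCoeff (fun x => g x - ∑ m ∈ s, a m * Real.cos (m * x)) n =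
      cosCoeff g n - ∑ m ∈ s, a m * cosCoeff (fun x => Real.cos (m * x)) n := by
  simp_rw [cosCoeff, mul_sub, Finset.mul_sum]
  rw [intervalIntegral.integral_sub (Continuous.intervalIntegrable (by fun_prop) _ _)
    (Continuous.intervalIntegrable (by fun_prop) _ _), intervalIntegral.integral_finsetSum
    (fun m _ => Continuous.intervalIntegrable (by fun_prop) _ _), mul_sub, Finset.mul_sum]
  simp_rw [mul_left_comm _ (a _), intervalIntegral.integral_const_mul, mul_left_comm _ (a _)]

/-- Subtracting the partial cosine sum of order `< N` kills the coefficients of order `< N`. -/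
theorem cosCoeff_sub_partialSum {g : ℝ → ℝ} (hg : Continuous g) (N : ℕ) (n : ℤ) :
    cosCoeff (fun x => g x - ∑ m ∈ Finset.Ioo (-N : ℤ) N, cosCoeff g m * Real.cos (m * x)) n =
      if n ∈ Finset.Ioo (-N : ℤ) N then 0 else cosCoeff g n := by
  rw [cosCoeff_sub_sum_cos hg]
  simp_rw [cosCoeff_cos, mul_div_assoc', mul_add, mul_ite, mul_one, mul_zero]
  rw [← Finset.sum_div, Finset.sum_add_distrib, Finset.sum_ite_eq]
  have h2 : ∀ m : ℤ, (n = -m) = (-n = m) := fun m => propext ⟨by lia, by lia⟩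
  simp_rw [h2, Finset.sum_ite_eq, Finset.mem_Ioo, cosCoeff_neg]
  have h3 : (-(N : ℤ) < -n ∧ -n < N) ↔ (-(N : ℤ) < n ∧ n < N) := by lia
  simp_rw [h3]
  split_ifs <;> ring

theorem integral_sub_partialSum_sq_le {g g' : ℝ → ℝ} (hg : ∀ x, HasDerivAt g (g' x) x)
    (hg' : Continuous g') (heven : ∀ x, g (-x) = g x) (N : ℕ) (hN : 0 < N) :
    ∫ x in (-Real.pi)..Real.pi,
      (g x - ∑ m ∈ Finset.Ioo (-N : ℤ) N, cosCoeff g m * Real.cos (m * x)) ^ 2 ≤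
      ((N : ℝ)⁻¹) ^ 2 * ∫ x in (-Real.pi)..Real.pi, g' x ^ 2 := by
  have hgc : Continuous g := continuous_iff_continuousAt.2 fun x => (hg x).continuousAt
  set h : ℝ → ℝ := fun x =>
    g x - ∑ m ∈ Finset.Ioo (-N : ℤ) N, cosCoeff g m * Real.cos (m * x) with hh
  have hhc : Continuous h := by fun_prop
  have hheven : ∀ x, h (-x) = h x := fun x => by simp [hh, heven]
  have parseval : ∀ u : ℝ → ℝ, Continuous u →
      HasSum (fun i => ‖fourierCoeffOn neg_pi_lt_pi (fun x => (u x : ℂ)) i‖ ^ 2)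
        ((2 * Real.pi)⁻¹ * ∫ x in (-Real.pi)..Real.pi, u x ^ 2) := by
    intro u hu
    have hm : MemLp (fun x => (u x : ℂ)) 2 (volume.restrict (Set.Ioc (-Real.pi) Real.pi)) := by
      rw [memLp_two_iff_integrable_sq_norm
        (Continuous.aestronglyMeasurable (by fun_prop))]
      exact Continuous.integrableOn_Ioc (by fun_prop)
    have := hasSum_sq_fourierCoeffOn neg_pi_lt_pi hm
    simpa [two_mul] using this
  have hle := hasSum_le (fun n => ?_) (parseval h hhc) ((parseval g' hg').mul_left (((N : ℝ)⁻¹) ^ 2))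
  · have hpi : 0 < (2 * Real.pi)⁻¹ := by positivity
    rw [mul_left_comm] at hle
    exact le_of_mul_le_mul_left hle hpi
  · rw [fourierCoeffOn_ofReal_of_even hhc hheven, cosCoeff_sub_partialSum hgc]
    split_ifs with hn
    · simp; positivity
    · rw [← fourierCoeffOn_ofReal_of_even hgc heven, ← mul_pow]
      have hn' : (N : ℤ) ≤ |n| := by
        rw [Finset.mem_Ioo] at hn
        rw [le_abs]; lia
      have hn'' : (N : ℝ) ≤ |(n : ℝ)| := by exact_mod_cast hn'
      have hn0 : n ≠ 0 := by rintro rfl; simp at hn'; lia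
      have hN' : (0 : ℝ) < N := by exact_mod_cast hN
      rw [fourierCoeffOn_of_hasDerivAt neg_pi_lt_pi (f' := fun x => (g' x : ℂ)) hn0
        (fun x _ => (hg x).ofReal_comp) (Continuous.intervalIntegrable (by fun_prop) _ _),
        heven]
      gcongr
      have hpi := Real.pi_pos
      have e : ((Real.pi : ℂ) - (-Real.pi : ℝ)) = 2 * Real.pi := by push_cast; ring
      rw [sub_self, mul_zero, zero_sub, e]
      simp only [norm_mul, norm_div, norm_neg, norm_one, Complex.norm_I, Complex.norm_real,
        Complex.norm_intCast, Complex.norm_ofNat, Real.norm_eq_abs, abs_of_pos hpi]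
      rw [← mul_assoc]
      gcongr
      have : |(n : ℝ)|⁻¹ ≤ (N : ℝ)⁻¹ := by gcongr
      refine le_trans (le_of_eq ?_) this
      field_simp

open Polynomial in
theorem natDegree_lt_of_degree_lt {p : ℝ[X]} {n : ℕ} (hn : n ≠ 0) (h : p.degree < n) :
    p.natDegree < n := by
  rcases eq_or_ne p 0 with rfl | h0
  · simpa using Nat.pos_of_ne_zero hn
  · exact (natDegree_lt_iff_degree_lt h0).2 h

open Polynomial in
theorem exists_derivative_eq_of_degree_lt (q : ℝ[X]) (n : ℕ) (hq : q.degree < n) :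
    ∃ Q : ℝ[X], Q.degree < (n + 1 : ℕ) ∧ derivative Q = q := by
  refine ⟨∑ i ∈ Finset.range n, monomial (i + 1) (q.coeff i / (i + 1)), ?_, ?_⟩
  · rw [← mem_degreeLT]
    refine Submodule.sum_mem _ fun i hi => mem_degreeLT.2 ?_
    refine (degree_monomial_le _ _).trans_lt ?_
    have := Finset.mem_range.1 hi
    exact_mod_cast Nat.succ_lt_succ this
  · rcases eq_or_ne q 0 with rfl | h0
    · simp
    conv_rhs => rw [q.as_sum_range' n ((natDegree_lt_iff_degree_lt h0).2 hq)]
    rw [derivative_sum]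
    refine Finset.sum_congr rfl fun i _ => ?_
    rw [derivative_monomial]
    have : (i : ℝ) + 1 ≠ 0 := by positivity
    simp [this]

theorem add_mul_cos_mem_Icc {c r : ℝ} (hr : 0 ≤ r) (x : ℝ) :
    c + r * Real.cos x ∈ Set.Icc (c - r) (c + r) :=
  ⟨by nlinarith [Real.neg_one_le_cos x], by nlinarith [Real.cos_le_one x]⟩

open Polynomial in
/-- One step of Jackson's inequality, in the `L²` norm with respect to the Chebyshev weight. -/
theorem exists_polynomial_integral_cos_sq_le {f f' : ℝ → ℝ} {c r : ℝ} (hr : 0 < r)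
    (hf : ∀ x ∈ Set.Icc (c - r) (c + r), HasDerivWithinAt f (f' x) (Set.Icc (c - r) (c + r)) x)
    (hf' : ContinuousOn f' (Set.Icc (c - r) (c + r))) (N : ℕ) (hN : 0 < N) :
    ∃ p : ℝ[X], p.degree < N ∧
      ∫ x in (-Real.pi)..Real.pi,
        (f (c + r * Real.cos x) - p.eval (c + r * Real.cos x)) ^ 2 ≤
      (r / N) ^ 2 * ∫ x in (-Real.pi)..Real.pi, f' (c + r * Real.cos x) ^ 2 := by
  have hmem := add_mul_cos_mem_Icc (c := c) hr.le
  have hinner : ∀ x, HasDerivAt (fun x => c + r * Real.cos x) (r * -Real.sin x) x := fun x =>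
    ((Real.hasDerivAt_cos x).const_mul r).const_add c
  have hf'c : Continuous fun x => f' (c + r * Real.cos x) :=
    hf'.comp_continuous (by fun_prop) hmem
  set g : ℝ → ℝ := fun x => f (c + r * Real.cos x) with hg
  have hgd : ∀ x, HasDerivAt g (f' (c + r * Real.cos x) * (r * -Real.sin x)) x := by
    intro x
    rw [← hasDerivWithinAt_univ]
    exact (hf _ (hmem x)).comp x (hinner x).hasDerivWithinAt fun y _ => hmem y
  have key := integral_sub_partialSum_sq_le hgd (hf'c.mul (by fun_prop)) (fun x => by simp [hg]) N hN
  refine ⟨(∑ m ∈ Finset.Ioo (-N : ℤ) N, C (cosCoeff g m) * Chebyshev.T ℝ m).comp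
    (C r⁻¹ * (X - C c)), ?_, ?_⟩
  · have h1 : (∑ m ∈ Finset.Ioo (-N : ℤ) N, C (cosCoeff g m) * Chebyshev.T ℝ m).degree < N := by
      rw [← mem_degreeLT]
      refine Submodule.sum_mem _ fun m hm => ?_
      rw [← smul_eq_C_mul]
      refine Submodule.smul_mem _ _ (mem_degreeLT.2 ?_)
      rw [Chebyshev.degree_T]
      rw [Finset.mem_Ioo] at hm
      have : m.natAbs < N := by lia
      exact_mod_cast this
    have h2 : (C r⁻¹ * (X - C c)).natDegree ≤ 1 := by compute_degree
    refine degree_le_natDegree.trans_lt ?_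
    have h3 := natDegree_comp_le (p := ∑ m ∈ Finset.Ioo (-N : ℤ) N,
      C (cosCoeff g m) * Chebyshev.T ℝ m) (q := C r⁻¹ * (X - C c))
    have h4 := (natDegree_lt_of_degree_lt hN.ne' h1)
    have : ((∑ m ∈ Finset.Ioo (-N : ℤ) N, C (cosCoeff g m) * Chebyshev.T ℝ m).comp
      (C r⁻¹ * (X - C c))).natDegree < N := by nlinarith
    exact_mod_cast this
  · have h5 : ∀ x, ((∑ m ∈ Finset.Ioo (-N : ℤ) N, C (cosCoeff g m) * Chebyshev.T ℝ m).comp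
        (C r⁻¹ * (X - C c))).eval (c + r * Real.cos x) =
        ∑ m ∈ Finset.Ioo (-N : ℤ) N, cosCoeff g m * Real.cos (m * x) := by
      intro x
      have : r⁻¹ * (c + r * Real.cos x - c) = Real.cos x := by field_simp; ring
      simp only [eval_comp, eval_finsetSum, eval_mul, eval_C, eval_sub, eval_X, this,
        Chebyshev.T_real_cos]
    simp_rw [h5]
    refine key.trans ?_
    rw [div_eq_inv_mul, mul_pow, mul_assoc]
    gcongr
    rw [← intervalIntegral.integral_const_mul]
    refine intervalIntegral.integral_mono_on neg_pi_lt_pi.le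
      (((hf'c.mul (by fun_prop)).pow 2).intervalIntegrable _ _)
      (((hf'c.pow 2).const_mul _).intervalIntegrable _ _) fun x _ => ?_
    nlinarith [mul_nonneg (sq_nonneg (f' (c + r * Real.cos x) * r))
      (sub_nonneg.2 (Real.sin_sq_le_one x))]

open Polynomial in
theorem exists_polynomial_integral_cos_sq_le_iterate {c r : ℝ} (hr : 0 < r) (k : ℕ) :
    ∀ (N : ℕ), k ≤ N → ∀ f : ℝ → ℝ, ContDiffOn ℝ k f (Set.Icc (c - r) (c + r)) →
    ∃ p : ℝ[X], p.degree < N ∧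
      ∫ x in (-Real.pi)..Real.pi,
        (f (c + r * Real.cos x) - p.eval (c + r * Real.cos x)) ^ 2 ≤
      (r ^ k / N.descFactorial k) ^ 2 * ∫ x in (-Real.pi)..Real.pi,
        iteratedDerivWithin k f (Set.Icc (c - r) (c + r)) (c + r * Real.cos x) ^ 2 := by
  induction k with
  | zero => exact fun N _ f _ => ⟨0, by simp, by simp⟩
  | succ k ih =>
    intro N hN f hf
    obtain ⟨N, rfl⟩ : ∃ m, N = m + 1 := ⟨N - 1, by lia⟩
    have hu : UniqueDiffOn ℝ (Set.Icc (c - r) (c + r)) := uniqueDiffOn_Icc (by linarith)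
    have hf' : ContDiffOn ℝ k (derivWithin f (Set.Icc (c - r) (c + r)))
        (Set.Icc (c - r) (c + r)) := hf.derivWithin hu (by norm_cast)
    obtain ⟨q, hq, hqe⟩ := ih N (by lia) _ hf'
    obtain ⟨Q, hQ, hQd⟩ := exists_derivative_eq_of_degree_lt q N hq
    obtain ⟨p, hp, hpe⟩ := exists_polynomial_integral_cos_sq_le (f := fun x => f x - Q.eval x)
      (f' := fun x => derivWithin f (Set.Icc (c - r) (c + r)) x - q.eval x) hr
      (fun x hx => by
        rw [← hQd]
        exact ((hf.differentiableOn (by simp)) x hx).hasDerivWithinAt.sub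
          (Q.hasDerivAt x).hasDerivWithinAt)
      (hf'.continuousOn.sub q.continuous.continuousOn) (N + 1) N.succ_pos
    refine ⟨p + Q, (degree_add_le _ _).trans_lt (max_lt hp hQ), ?_⟩
    simp_rw [eval_add, ← sub_sub, sub_right_comm _ (eval _ p)]
    refine hpe.trans ?_
    refine (mul_le_mul_of_nonneg_left hqe (sq_nonneg _)).trans (le_of_eq ?_)
    rw [← mul_assoc, ← mul_pow, div_mul_div_comm, ← pow_succ', iteratedDerivWithin_succ',
      Nat.succ_descFactorial_succ, Nat.cast_mul]

theorem pow_le_pow_mul_descFactorial {k N : ℕ} (h : k ≤ N) :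
    N ^ k ≤ k ^ k * N.descFactorial k := by
  rcases Nat.eq_zero_or_pos k with rfl | hk
  · simp
  refine (Nat.pow_le_pow_left ?_ k).trans ((mul_pow k (N + 1 - k) k).le.trans
    (Nat.mul_le_mul_left _ (Nat.pow_sub_le_descFactorial N k)))
  obtain ⟨m, rfl⟩ := Nat.exists_eq_add_of_le h
  rw [show k + m + 1 - k = m + 1 by lia]
  nlinarith

theorem integral_Icc_le_integral_cos {c r : ℝ} (hr : 0 < r) {F : ℝ → ℝ}
    (hF : ContinuousOn F (Set.Icc (c - r) (c + r)))
    (h0 : ∀ x ∈ Set.Icc (c - r) (c + r), 0 ≤ F x) :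
    ∫ x in Set.Icc (c - r) (c + r), F x ≤
      r * ∫ x in (-Real.pi)..Real.pi, F (c + r * Real.cos x) := by
  have hmem := add_mul_cos_mem_Icc (c := c) hr.le
  have hFc : Continuous fun x => F (c + r * Real.cos x) :=
    hF.comp_continuous (by fun_prop) hmem
  have hsub := intervalIntegral.integral_comp_mul_deriv' (a := -Real.pi) (b := 0)
    (f := fun x => c + r * Real.cos x) (f' := fun x => r * -Real.sin x) (g := F)
    (fun x _ => ((Real.hasDerivAt_cos x).const_mul r).const_add c) (by fun_prop)
    (hF.mono (by rintro _ ⟨x, _, rfl⟩; exact hmem x))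
  simp only [Real.cos_neg, Real.cos_pi, Real.cos_zero, mul_neg, mul_one, ← sub_eq_add_neg] at hsub
  rw [integral_Icc_eq_integral_Ioc, ← intervalIntegral.integral_of_le (by linarith), ← hsub,
    ← intervalIntegral.integral_const_mul]
  have hpi := Real.pi_pos
  calc _ ≤ ∫ x in (-Real.pi)..0, r * F (c + r * Real.cos x) := by
        refine intervalIntegral.integral_mono_on (by linarith)
          (Continuous.intervalIntegrable (hFc.mul (by fun_prop)).neg _ _)
          ((hFc.const_mul r).intervalIntegrable _ _) fun x _ => ?_
        simp only [Function.comp_def]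
        nlinarith [mul_nonneg (mul_nonneg hr.le (h0 _ (hmem x)))
          (by linarith [Real.neg_one_le_sin x] : 0 ≤ 1 + Real.sin x)]
    _ ≤ _ := by
        refine intervalIntegral.integral_mono_interval le_rfl (by linarith) (by linarith)
          (ae_of_all _ fun x => mul_nonneg hr.le (h0 _ (hmem x)))
          ((hFc.const_mul r).intervalIntegrable _ _)

/-- **Theorem 1 (second half) of FiLM.** For the uniform probability measure
`μ^{(t)} = θ⁻¹ · Leb|_{[t-θ,t]}`, every function that is `k` times continuously
differentiable on `[t-θ,t]` with `k`-th derivative bounded by `M` there admits a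
polynomial approximation of degree at most `N - 1` (for any `N ≥ k`) with
`L²(μ^{(t)})` error at most `C_k · M · θ^k · N^{-k+1/2}`, where `C_k` depends only
on `k`. -/
theorem legendre_projection_error_smooth (k : ℕ) (hk : 1 ≤ k) :
    ∃ C : ℝ, 0 < C ∧
      ∀ (θ t : ℝ), 0 < θ → ∀ M : ℝ, 0 ≤ M → ∀ N : ℕ, k ≤ N →
        ∀ f : ℝ → ℝ,
          ContDiffOn ℝ k f (Set.Icc (t - θ) t) →
          (∀ x ∈ Set.Icc (t - θ) t,
            |iteratedDerivWithin k f (Set.Icc (t - θ) t) x| ≤ M) →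
          ∃ p : Polynomial ℝ, p.natDegree ≤ N - 1 ∧
            Real.sqrt (∫ x, (f x - p.eval x) ^ 2
                ∂((ENNReal.ofReal θ)⁻¹ • volume.restrict (Set.Icc (t - θ) t)))
              ≤ C * M * θ ^ k * (N : ℝ) ^ (-(k : ℝ) + 1 / 2) := by
  have hk0 : (0 : ℝ) < k := by exact_mod_cast hk
  have hpi := Real.pi_pos
  refine ⟨Real.sqrt Real.pi * k ^ k, by positivity, ?_⟩
  intro θ t hθ M hM N hN f hf hfM
  obtain ⟨c, r, hr, rfl, rfl⟩ : ∃ c r : ℝ, 0 < r ∧ t = c + r ∧ θ = 2 * r :=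
    ⟨t - θ / 2, θ / 2, by positivity, by ring, by ring⟩
  have hIcc : c + r - 2 * r = c - r := by ring
  rw [hIcc] at hf hfM ⊢
  obtain ⟨p, hp, hpe⟩ := exists_polynomial_integral_cos_sq_le_iterate hr k N hN f hf
  have hN0 : (0 : ℝ) < N := by exact_mod_cast (by lia : 0 < N)
  refine ⟨p, Nat.le_sub_one_of_lt
    ((natDegree_lt_of_degree_lt (by lia) hp)), ?_⟩
  have hmem := add_mul_cos_mem_Icc (c := c) hr.le
  have hD : ∫ x in (-Real.pi)..Real.pi,
      iteratedDerivWithin k f (Set.Icc (c - r) (c + r)) (c + r * Real.cos x) ^ 2 ≤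
      2 * Real.pi * M ^ 2 := by
    have hc : Continuous fun x =>
        iteratedDerivWithin k f (Set.Icc (c - r) (c + r)) (c + r * Real.cos x) :=
      (hf.continuousOn_iteratedDerivWithin le_rfl
        (uniqueDiffOn_Icc (by linarith))).comp_continuous (by fun_prop) hmem
    calc _ ≤ ∫ x in (-Real.pi)..Real.pi, M ^ 2 :=
          intervalIntegral.integral_mono_on neg_pi_lt_pi.le
            (Continuous.intervalIntegrable (by fun_prop) _ _)
            (Continuous.intervalIntegrable (by fun_prop) _ _)
            fun x _ => sq_le_sq.2 ((hfM _ (hmem x)).trans (le_abs_self M))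
      _ = _ := by
          rw [intervalIntegral.integral_const, smul_eq_mul]
          ring
  have hint := integral_Icc_le_integral_cos hr (F := fun x => (f x - p.eval x) ^ 2)
    ((hf.continuousOn.sub p.continuous.continuousOn).pow 2) fun x _ => sq_nonneg _
  have hdesc : r ^ k / (N.descFactorial k : ℝ) ≤ r ^ k * k ^ k * ((N : ℝ) ^ k)⁻¹ := by
    have hd : (0 : ℝ) < N.descFactorial k := by exact_mod_cast Nat.descFactorial_pos.2 hN
    have h : (N : ℝ) ^ k ≤ k ^ k * N.descFactorial k := by
      exact_mod_cast pow_le_pow_mul_descFactorial hN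
    rw [← div_eq_mul_inv, div_le_div_iff₀ hd (by positivity), mul_assoc]
    gcongr
  have hpow : ((N : ℝ) ^ k)⁻¹ ≤ (N : ℝ) ^ (-(k : ℝ) + 1 / 2) := by
    rw [← Real.rpow_natCast, ← Real.rpow_neg hN0.le]
    exact Real.rpow_le_rpow_of_exponent_le (by exact_mod_cast (by lia : 1 ≤ N)) (by linarith)
  have hrk : r ^ k ≤ (2 * r) ^ k := by gcongr; linarith
  rw [integral_smul_measure, ENNReal.toReal_inv, ENNReal.toReal_ofReal hθ.le, smul_eq_mul]
  calc _ ≤ Real.sqrt ((Real.sqrt Real.pi * (r ^ k / N.descFactorial k) * M) ^ 2) := by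
        refine Real.sqrt_le_sqrt ?_
        rw [inv_mul_le_iff₀ hθ]
        refine hint.trans ?_
        refine (mul_le_mul_of_nonneg_left (hpe.trans
          (mul_le_mul_of_nonneg_left hD (sq_nonneg _))) hr.le).trans (le_of_eq ?_)
        rw [mul_pow, mul_pow, Real.sq_sqrt hpi.le]
        ring
    _ = Real.sqrt Real.pi * (r ^ k / N.descFactorial k) * M := Real.sqrt_sq (by positivity)
    _ ≤ Real.sqrt Real.pi * ((2 * r) ^ k * k ^ k * (N : ℝ) ^ (-(k : ℝ) + 1 / 2)) * M := by
        gcongr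
        exact hdesc.trans (by gcongr)
    _ = _ := by ring
end
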